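/- arXiv:2005.14068 — 12 statements merged into one kernel-verified Lean document; each statement's English description precedes it below -/
import Mathlib

section
/- Let r be a table over attributes A and B with a strict linear order <_A on D_A, and suppose both functional dependencies A→B and B→A hold in r (so co-occurrence of values defines a bijection f from D_B to D_A). Then the explicit-to-implicit candidate A ~ B* is valid, and every witness order derives the same strict total order on D_B, namely b ≺ b' iff f(b) <_A f(b'); in particular the implied domain order over B is a unique strong total order. -/
/-- The functional dependency: any two tuples with equal values under `f`
have equal values under `g`. -/
def FDhold {T α β : Type*} (f : T → α) (g : T → β) : Prop :=
  ∀ s t : T, f s = f t → g s = g t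

/-- A witness order for the explicit-to-implicit candidate `A ~ B*`:
a strict linear order on the tuples that is compatible with the explicit
order `<` on A-values and under which the B-values form intervals. -/
structure IsEIWitness {T α β : Type*} [LinearOrder α] (fA : T → α) (fB : T → β)
    (w : T → T → Prop) : Prop where
  total : ∀ s t : T, s ≠ t → w s t ∨ w t s
  irrefl : ∀ s : T, ¬ w s s
  trans : ∀ s t u : T, w s t → w t u → w s u
  compat : ∀ s t : T, w s t → ¬ (fA t < fA s)
  interval : ∀ s t u : T, w s t → w t u → fB s = fB u → fB s = fB t

/-- The strict total order on B-values derived from a witness order: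
`b` precedes `b'` iff the block of tuples with B-value `b` precedes the
block with B-value `b'`. -/
def derivedB {T β : Type*} (fB : T → β) (w : T → T → Prop) (b b' : β) : Prop :=
  b ≠ b' ∧ ∃ s t : T, fB s = b ∧ fB t = b' ∧ w s t

/-- If both FDs `A → B` and `B → A` hold (so co-occurrence defines a bijection
`f` from B-values to A-values), then the candidate `A ~ B*` is valid, and every
witness order derives the same strict total order on the B-values, namely
`b ≺ b'` iff `f(b) < f(b')` (i.e., iff some tuple with B-value `b` has an
A-value less than that of some tuple with B-value `b'`). -/
theorem stmt0 {T α β : Type*} [Fintype T] [Nonempty T] [LinearOrder α]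
    (fA : T → α) (fB : T → β)
    (hAB : FDhold fA fB) (hBA : FDhold fB fA) :
    (∃ w : T → T → Prop, IsEIWitness fA fB w) ∧
    (∀ w : T → T → Prop, IsEIWitness fA fB w →
      ∀ b b' : β, (∃ s : T, fB s = b) → (∃ t : T, fB t = b') →
        (derivedB fB w b b' ↔ ∃ s t : T, fB s = b ∧ fB t = b' ∧ fA s < fA t)) := by
  constructor
  · let e := Fintype.equivFin T
    refine ⟨fun s t => fA s < fA t ∨ (fA s = fA t ∧ e s < e t), ?_, ?_, ?_, ?_, ?_⟩
    · intro s t hst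
      rcases lt_trichotomy (fA s) (fA t) with h | h | h
      · exact Or.inl (Or.inl h)
      · rcases lt_or_gt_of_ne (fun h' => hst (e.injective h')) with h' | h'
        · exact Or.inl (Or.inr ⟨h, h'⟩)
        · exact Or.inr (Or.inr ⟨h.symm, h'⟩)
      · exact Or.inr (Or.inl h)
    · rintro s (h | ⟨_, h⟩)
      · exact lt_irrefl _ h
      · exact lt_irrefl _ h
    · rintro s t u (h | ⟨h, h1⟩) (k | ⟨k, k1⟩)
      · exact Or.inl (h.trans k)
      · exact Or.inl (k ▸ h)
      · exact Or.inl (h ▸ k)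
      · exact Or.inr ⟨h.trans k, h1.trans k1⟩
    · rintro s t (h | ⟨h, _⟩)
      · exact not_lt_of_gt h
      · rw [h]
        exact lt_irrefl _
    · intro s t u h k hsu
      have hA := hBA s u hsu
      have h1 : fA s ≤ fA t := h.elim le_of_lt (fun x => x.1.le)
      have h2 : fA t ≤ fA u := k.elim le_of_lt (fun x => x.1.le)
      exact hAB s t (le_antisymm h1 (hA ▸ h2))
  · intro w hw b b' _ _
    constructor
    · rintro ⟨hne, s, t, hs, ht, hst⟩
      refine ⟨s, t, hs, ht, lt_of_le_of_ne (not_lt.mp (hw.compat s t hst)) ?_⟩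
      intro h
      exact hne (hs ▸ ht ▸ hAB s t h)
    · rintro ⟨s, t, hs, ht, hlt⟩
      refine ⟨?_, s, t, hs, ht, ?_⟩
      · intro h
        exact hlt.ne (hBA s t (hs.trans (h.trans ht.symm)))
      · have hne : s ≠ t := by
          rintro rfl
          exact lt_irrefl _ hlt
        rcases hw.total s t hne with h | h
        · exact h
        · exact absurd hlt (hw.compat t s h)
end

section
/- Let r be a table over attributes A and B with a strict linear order <_A on D_A such that the FD A→B holds in r. For each b ∈ D_B let E_b be the set of A-values co-occurring with b in r. Then the explicit-to-implicit candidate A ~ B* is valid iff the family {E_b : b ∈ D_B} is an interval partitioning with respect to <_A, i.e., there are no two distinct B-values b, b' with min E_b <_A min E_{b'} <_A max E_b. Moreover, when it is valid, every witness order derives the same strict total order on D_B, namely b ≺ b' iff max E_b <_A min E_{b'} (the order of the B-values as r is sorted by A). -/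
/-- `E_b`: the set of A-values co-occurring with the B-value `b`. -/
noncomputable def Egrp {T α β : Type*} [Fintype T] (fA : T → α) (fB : T → β) (b : β) :
    Finset α :=
  letI := Classical.decEq α
  letI := Classical.decEq β
  (Finset.univ.filter fun t => fB t = b).image fA

/-- The family `{E_b : b ∈ D_B}` is an interval partitioning: there are no two
distinct (occurring) B-values `b, b'` with `min E_b < min E_{b'} < max E_b`. -/
def IsIntervalPartitioning {T α β : Type*} [Fintype T] [LinearOrder α]
    (fA : T → α) (fB : T → β) : Prop :=
  ¬ ∃ (b b' : β), b ≠ b' ∧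
      ∃ (h : (Egrp fA fB b).Nonempty) (h' : (Egrp fA fB b').Nonempty),
        (Egrp fA fB b).min' h < (Egrp fA fB b').min' h' ∧
        (Egrp fA fB b').min' h' < (Egrp fA fB b).max' h

theorem mem_Egrp_iff {T α β : Type*} [Fintype T] (fA : T → α) (fB : T → β) (b : β) (a : α) :
    a ∈ Egrp fA fB b ↔ ∃ t, fB t = b ∧ fA t = a := by
  classical
  simp [Egrp]

theorem witness_lt {T α β : Type*} [LinearOrder α] {fA : T → α} {fB : T → β}
    {w : T → T → Prop} (hw : IsEIWitness fA fB w) {s t : T} (h : fA s < fA t) : w s t := by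
  rcases hw.total s t (by rintro rfl; exact lt_irrefl _ h) with h1 | h1
  · exact h1
  · exact absurd h (hw.compat _ _ h1)

theorem exists_witness {T α β : Type*} [Fintype T] [LinearOrder α]
    (fA : T → α) (fB : T → β) (hAB : FDhold fA fB) (hP : IsIntervalPartitioning fA fB) :
    ∃ w : T → T → Prop, IsEIWitness fA fB w := by
  have e := Fintype.equivFin T
  refine ⟨fun s t => fA s < fA t ∨ (fA s = fA t ∧ e s < e t), ?_, ?_, ?_, ?_, ?_⟩
  · intro s t hst
    have : e s ≠ e t := fun h => hst (e.injective h)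
    rcases lt_trichotomy (fA s) (fA t) with h | h | h
    · exact Or.inl (Or.inl h)
    · rcases lt_or_gt_of_ne this with h2 | h2
      · exact Or.inl (Or.inr ⟨h, h2⟩)
      · exact Or.inr (Or.inr ⟨h.symm, h2⟩)
    · exact Or.inr (Or.inl h)
  · rintro s (h | h)
    · exact lt_irrefl _ h
    · exact lt_irrefl _ h.2
  · rintro s t u (h | ⟨h, h'⟩) (k | ⟨k, k'⟩)
    · exact Or.inl (h.trans k)
    · exact Or.inl (k ▸ h)
    · exact Or.inl (h ▸ k)
    · exact Or.inr ⟨h.trans k, h'.trans k'⟩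
  · rintro s t (h | h)
    · exact h.le.not_gt
    · exact h.1.le.not_gt
  · intro s t u hst htu hsu
    by_contra hne
    have h1 : fA s < fA t := by
      rcases hst with h | h
      · exact h
      · exact absurd (hAB _ _ h.1) hne
    have h2 : fA t < fA u := by
      rcases htu with h | h
      · exact h
      · exact absurd (hsu.trans (hAB _ _ h.1).symm) hne
    have ms : fA s ∈ Egrp fA fB (fB s) := (mem_Egrp_iff ..).2 ⟨s, rfl, rfl⟩
    have mu : fA u ∈ Egrp fA fB (fB s) := (mem_Egrp_iff ..).2 ⟨u, hsu.symm, rfl⟩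
    have mt : fA t ∈ Egrp fA fB (fB t) := (mem_Egrp_iff ..).2 ⟨t, rfl, rfl⟩
    have l1 := Finset.min'_le _ _ ms
    have l2 := Finset.le_max' _ _ mu
    have l3 := Finset.min'_le _ _ mt
    have l4 := Finset.le_max' _ _ mt
    rcases lt_trichotomy ((Egrp fA fB (fB s)).min' ⟨_, ms⟩)
      ((Egrp fA fB (fB t)).min' ⟨_, mt⟩) with h | h | h
    · exact hP ⟨fB s, fB t, hne, ⟨_, ms⟩, ⟨_, mt⟩, h, (l3.trans_lt h2).trans_le l2⟩
    · obtain ⟨p, hp, hp'⟩ := (mem_Egrp_iff ..).1 (Finset.min'_mem _ ⟨_, ms⟩)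
      obtain ⟨q, hq, hq'⟩ := (mem_Egrp_iff ..).1 (Finset.min'_mem _ ⟨_, mt⟩)
      exact hne (hp ▸ hq ▸ hAB p q (hp'.trans (h.trans hq'.symm)))
    · exact hP ⟨fB t, fB s, Ne.symm hne, ⟨_, mt⟩, ⟨_, ms⟩, h, (l1.trans_lt h1).trans_le l4⟩

/-- Assume the FD `A → B` holds. Then the candidate `A ~ B*` is valid iff
`{E_b}` is an interval partitioning; moreover every witness order derives the
same strict total order on B-values, namely `b ≺ b'` iff `max E_b < min E_{b'}`. -/
theorem stmt1 {T α β : Type*} [Fintype T] [Nonempty T] [LinearOrder α]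
    (fA : T → α) (fB : T → β) (hAB : FDhold fA fB) :
    ((∃ w : T → T → Prop, IsEIWitness fA fB w) ↔ IsIntervalPartitioning fA fB) ∧
    (∀ w : T → T → Prop, IsEIWitness fA fB w →
      ∀ (b b' : β) (h : (Egrp fA fB b).Nonempty) (h' : (Egrp fA fB b').Nonempty),
        (derivedB fB w b b' ↔ (Egrp fA fB b).max' h < (Egrp fA fB b').min' h')) := by
  refine ⟨⟨?_, exists_witness fA fB hAB⟩, ?_⟩
  · rintro ⟨w, hw⟩ ⟨b, b', hne, h, h', h1, h2⟩
    obtain ⟨p, hp, hp'⟩ := (mem_Egrp_iff ..).1 (Finset.min'_mem _ h)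
    obtain ⟨q, hq, hq'⟩ := (mem_Egrp_iff ..).1 (Finset.min'_mem _ h')
    obtain ⟨u, hu, hu'⟩ := (mem_Egrp_iff ..).1 (Finset.max'_mem _ h)
    rw [← hp', ← hq'] at h1
    rw [← hq', ← hu'] at h2
    have := hw.interval p q u (witness_lt hw h1) (witness_lt hw h2) (hp.trans hu.symm)
    exact hne (hp.symm.trans (this.trans hq))
  · intro w hw b b' h h'
    obtain ⟨q, hq, hq'⟩ := (mem_Egrp_iff ..).1 (Finset.min'_mem _ h')
    obtain ⟨p, hp, hp'⟩ := (mem_Egrp_iff ..).1 (Finset.max'_mem _ h)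
    constructor
    · rintro ⟨hne, s, t, hs, ht, hst⟩
      rw [← hp', ← hq']
      rcases lt_trichotomy (fA p) (fA q) with k | k | k
      · exact k
      · exact absurd (hp.symm.trans ((hAB _ _ k).trans hq)) hne
      · exfalso
        have hqp := witness_lt hw k
        have hsq : s ≠ q := by
          rintro rfl
          exact hne (hs.symm.trans hq)
        rcases hw.total s q hsq with m | m
        · exact hne (hs.symm.trans ((hw.interval s q p m hqp (hs.trans hp.symm)).trans hq))
        · exact hne (hs.symm.trans ((hw.interval q s t m hst (hq.trans ht.symm)).symm.trans hq))
    · intro hlt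
      refine ⟨?_, p, q, hp, hq, witness_lt hw (by rw [hp', hq']; exact hlt)⟩
      rintro rfl
      exact absurd hlt (Finset.min'_le _ _ (Finset.max'_mem _ h)).not_gt
end

section
/- Let r be a table over attributes A and B with a strict linear order <_A on D_A such that the FD B→A holds in r, and let f(b) denote the unique A-value co-occurring with each b ∈ D_B. Then the explicit-to-implicit candidate A ~ B* is valid, and the intersection, over all witness orders, of the derived strict total orders on D_B equals exactly the relation { (b, b') : f(b) <_A f(b') }, which is a weak total order on D_B whose blocks are the fibers of f. -/
theorem lexWitness {T α β : Type*} [LinearOrder α]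
    (fA : T → α) (fB : T → β)
    (f : β → α) (hf : ∀ t : T, f (fB t) = fA t)
    (rB : β → β → Prop) (rT : T → T → Prop)
    (hB1 : ∀ x y, x ≠ y → rB x y ∨ rB y x) (hB2 : ∀ x, ¬ rB x x)
    (hB3 : ∀ x y z, rB x y → rB y z → rB x z)
    (hT1 : ∀ x y, x ≠ y → rT x y ∨ rT y x) (hT2 : ∀ x, ¬ rT x x)
    (hT3 : ∀ x y z, rT x y → rT y z → rT x z) :
    IsEIWitness fA fB (fun s t => f (fB s) < f (fB t) ∨
      (f (fB s) = f (fB t) ∧ (rB (fB s) (fB t) ∨ (fB s = fB t ∧ rT s t)))) where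
  total s t h := by
    rcases lt_trichotomy (f (fB s)) (f (fB t)) with h1 | h1 | h1
    · exact Or.inl (Or.inl h1)
    · by_cases h2 : fB s = fB t
      · rcases hT1 s t h with h3 | h3
        · exact Or.inl (Or.inr ⟨h1, Or.inr ⟨h2, h3⟩⟩)
        · exact Or.inr (Or.inr ⟨h1.symm, Or.inr ⟨h2.symm, h3⟩⟩)
      · rcases hB1 _ _ h2 with h3 | h3
        · exact Or.inl (Or.inr ⟨h1, Or.inl h3⟩)
        · exact Or.inr (Or.inr ⟨h1.symm, Or.inl h3⟩)
    · exact Or.inr (Or.inl h1)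
  irrefl s h := by
    rcases h with h | ⟨_, h | ⟨_, h⟩⟩
    · exact lt_irrefl _ h
    · exact hB2 _ h
    · exact hT2 _ h
  trans s t u h k := by
    rcases h with h | ⟨e, h⟩ <;> rcases k with k | ⟨e', k⟩
    · exact Or.inl (h.trans k)
    · exact Or.inl (e' ▸ h)
    · exact Or.inl (e ▸ k)
    · refine Or.inr ⟨e.trans e', ?_⟩
      rcases h with h | ⟨e, h⟩ <;> rcases k with k | ⟨e', k⟩
      · exact Or.inl (hB3 _ _ _ h k)
      · exact Or.inl (e' ▸ h)
      · exact Or.inl (e ▸ k)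
      · exact Or.inr ⟨e.trans e', hT3 _ _ _ h k⟩
  compat s t h := by
    rw [← hf, ← hf]
    rcases h with h | ⟨h, _⟩
    · exact h.le.not_gt
    · exact h.le.not_gt
  interval s t u h k e := by
    rw [← e] at k
    rcases h with h | ⟨_, h | ⟨h, _⟩⟩
    · rcases k with k | ⟨k, _⟩
      · exact absurd k h.not_gt
      · exact absurd k h.ne'
    · rcases k with k | ⟨_, k | ⟨k, _⟩⟩
      · simp_all
      · exact absurd (hB3 _ _ _ h k) (hB2 _)
      · exact k.symm
    · exact h

/-- Suppose the FD `B → A` holds, with `f b` the unique A-value co-occurring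
with each B-value `b` (i.e. `f (fB t) = fA t` for every tuple `t`).  Then the
candidate `A ~ B*` is valid, the intersection over all witness orders of the
derived strict total orders on the occurring B-values is exactly
`{(b, b') : f b < f b'}`, and this relation is a weak total order on the
occurring B-values whose blocks are the fibers of `f`. -/
theorem stmt2 {T α β : Type*} [Fintype T] [Nonempty T] [LinearOrder α]
    (fA : T → α) (fB : T → β) (hBA : FDhold fB fA)
    (f : β → α) (hf : ∀ t : T, f (fB t) = fA t) :
    (∃ w : T → T → Prop, IsEIWitness fA fB w) ∧
    (∀ b b' : β, (∃ t : T, fB t = b) → (∃ t : T, fB t = b') →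
      ((∀ w : T → T → Prop, IsEIWitness fA fB w → derivedB fB w b b') ↔ f b < f b')) ∧
    (∃ (k : ℕ) (g : β → Fin k),
      (∀ b : β, (∃ t : T, fB t = b) → ∀ b' : β, (∃ t : T, fB t = b') →
        (f b < f b' ↔ g b < g b')) ∧
      (∀ b : β, (∃ t : T, fB t = b) → ∀ b' : β, (∃ t : T, fB t = b') →
        (g b = g b' ↔ f b = f b'))) := by
  classical
  have hwt : ∀ x y : β, x ≠ y → WellOrderingRel x y ∨ WellOrderingRel y x := by
    intro x y h
    rcases trichotomous_of WellOrderingRel x y with h1 | h1 | h1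
    · exact Or.inl h1
    · exact absurd h1 h
    · exact Or.inr h1
  have hwT : ∀ x y : T, x ≠ y → WellOrderingRel x y ∨ WellOrderingRel y x := by
    intro x y h
    rcases trichotomous_of WellOrderingRel x y with h1 | h1 | h1
    · exact Or.inl h1
    · exact absurd h1 h
    · exact Or.inr h1
  have hw1 := lexWitness fA fB f hf WellOrderingRel WellOrderingRel
    hwt (fun x => irrefl x) (fun x y z h k => _root_.trans h k)
    hwT (fun x => irrefl x) (fun x y z h k => _root_.trans h k)
  have hw2 := lexWitness fA fB f hf (fun x y => WellOrderingRel y x) WellOrderingRel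
    (fun x y h => (hwt x y h).symm) (fun x => irrefl x) (fun x y z h k => _root_.trans k h)
    hwT (fun x => irrefl x) (fun x y z h k => _root_.trans h k)
  refine ⟨⟨_, hw1⟩, ?_, ?_⟩
  · rintro b b' ⟨t, rfl⟩ ⟨t', rfl⟩
    constructor
    · intro H
      have h1 := H _ hw1
      have h2 := H _ hw2
      obtain ⟨hne, s, u, hs, hu, h1⟩ := h1
      obtain ⟨-, s', u', hs', hu', h2⟩ := h2
      simp only [hs, hu] at h1
      simp only [hs', hu'] at h2
      rcases h1 with h1 | ⟨_, h1 | ⟨h1, _⟩⟩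
      · exact h1
      · rcases h2 with h2 | ⟨_, h2 | ⟨h2, _⟩⟩
        · exact h2
        · exact absurd (_root_.trans h1 h2) (irrefl (r := WellOrderingRel) _)
        · exact absurd h2 hne
      · exact absurd h1 hne
    · intro h w hw
      refine ⟨fun e => h.ne (congrArg f e), t, t', rfl, rfl, ?_⟩
      have hne : t ≠ t' := by rintro rfl; exact lt_irrefl _ h
      rcases hw.total t t' hne with h1 | h1
      · exact h1
      · refine absurd ?_ (hw.compat _ _ h1)
        rwa [← hf, ← hf]
  · let c : α → ℕ := fun a => ((Finset.univ.image fA).filter (· < a)).card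
    have hc : ∀ a, c a < Fintype.card T + 1 := fun a =>
      Nat.lt_succ_of_le ((Finset.card_filter_le _ _).trans Finset.card_image_le)
    have hmono : ∀ (t : T) (a : α), f (fB t) < a → c (f (fB t)) < c a := by
      intro t a h
      apply Finset.card_lt_card
      rw [Finset.ssubset_iff_of_subset]
      · refine ⟨f (fB t), ?_, ?_⟩
        · simp only [Finset.mem_filter, Finset.mem_image, Finset.mem_univ, true_and]
          exact ⟨⟨t, (hf t).symm⟩, h⟩
        · simp
      · intro x hx
        simp only [Finset.mem_filter] at hx ⊢
        exact ⟨hx.1, hx.2.trans h⟩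
    refine ⟨Fintype.card T + 1, fun b => ⟨c (f b), hc _⟩, ?_, ?_⟩
    · rintro _ ⟨t, rfl⟩ _ ⟨t', rfl⟩
      rw [Fin.mk_lt_mk]
      refine ⟨hmono t _, fun h => ?_⟩
      by_contra h'
      rcases (not_lt.1 h').lt_or_eq with h1 | h1
      · exact absurd (hmono t' _ h1) h.not_gt
      · rw [h1] at h; exact lt_irrefl _ h
    · rintro _ ⟨t, rfl⟩ _ ⟨t', rfl⟩
      rw [Fin.mk.injEq]
      refine ⟨fun h => ?_, fun h => by rw [h]⟩
      rcases lt_trichotomy (f (fB t)) (f (fB t')) with h1 | h1 | h1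
      · exact absurd h (hmono t _ h1).ne
      · exact h1
      · exact absurd h (hmono t' _ h1).ne'
end

section
/- Let r be a table over attributes A and B with a strict linear order <_A on D_A, partitioned (by a context) into nonempty groups r_1, ..., r_p. Suppose that within each group r_i the explicit-to-implicit candidate A ~ B* is valid, and let G_i be the strongest derivable order of group r_i, i.e., the intersection, over all witness orders of r_i, of the derived strict total orders on the B-values of r_i. Then there exist witness orders w_1, ..., w_p (one per group) such that the union of their derived orders on B-values is acyclic (equivalently, there exists a strict partial order B* on D_B containing the derived order of some witness of every group) iff the union of the relations G_1, ..., G_p is acyclic. -/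
/-- A witness order for the explicit-to-implicit candidate `A ~ B*` over the
set `S` of tuples: a strict linear order on the tuples of `S` compatible with
the explicit order on A-values, under which B-values form intervals. -/
structure IsEIWitnessOn {T α β : Type*} [LinearOrder α] (fA : T → α) (fB : T → β)
    (S : Set T) (w : T → T → Prop) : Prop where
  total : ∀ s ∈ S, ∀ t ∈ S, s ≠ t → w s t ∨ w t s
  irrefl : ∀ s ∈ S, ¬ w s s
  trans : ∀ s ∈ S, ∀ t ∈ S, ∀ u ∈ S, w s t → w t u → w s u
  compat : ∀ s ∈ S, ∀ t ∈ S, w s t → ¬ (fA t < fA s)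
  interval : ∀ s ∈ S, ∀ t ∈ S, ∀ u ∈ S, w s t → w t u → fB s = fB u → fB s = fB t

/-- The strict total order derived by a witness order of the group `S`
on the B-values occurring in `S`. -/
def derivedBOn {T β : Type*} (fB : T → β) (S : Set T) (w : T → T → Prop)
    (b b' : β) : Prop :=
  b ≠ b' ∧ ∃ s ∈ S, ∃ t ∈ S, fB s = b ∧ fB t = b' ∧ w s t

/-- A relation is acyclic: its transitive closure is irreflexive. -/
def Acyclic {β : Type*} (R : β → β → Prop) : Prop :=
  ∀ b : β, ¬ Relation.TransGen R b b

/-- Let the table be partitioned by a context into nonempty groups (the fibers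
of `c`), with the candidate `A ~ B*` valid within each group, and let `G_i` be
the strongest derivable order of group `i` (the intersection over all witness
orders of group `i` of the derived orders).  Then there is a choice of one
witness order per group whose derived orders have an acyclic union iff the
union of the relations `G_i` is acyclic. -/
theorem stmt4 {T α β ι : Type*} [Fintype T] [LinearOrder α]
    (fA : T → α) (fB : T → β) (c : T → ι)
    (hne : ∀ i : ι, ∃ t : T, c t = i)
    (hvalid : ∀ i : ι, ∃ w : T → T → Prop, IsEIWitnessOn fA fB {t | c t = i} w) :
    (∃ w : ι → T → T → Prop,
        (∀ i : ι, IsEIWitnessOn fA fB {t | c t = i} (w i)) ∧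
        Acyclic (fun b b' => ∃ i : ι, derivedBOn fB {t | c t = i} (w i) b b'))
    ↔
    Acyclic (fun b b' => ∃ i : ι, ∀ w : T → T → Prop,
        IsEIWitnessOn fA fB {t | c t = i} w → derivedBOn fB {t | c t = i} w b b') := by
  classical
  constructor
  · rintro ⟨w, hw, hac⟩ b hb
    refine hac b (Relation.TransGen.mono ?_ b b hb)
    rintro x y ⟨i, hi⟩
    exact ⟨i, hi (w i) (hw i)⟩
  · intro hac
    set G : β → β → Prop := fun b b' => ∃ i : ι, ∀ w : T → T → Prop,
        IsEIWitnessOn fA fB {t | c t = i} w → derivedBOn fB {t | c t = i} w b b' with hG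
    have hpo : IsPartialOrder β (Relation.ReflTransGen G) :=
      { refl := fun _ => Relation.ReflTransGen.refl
        trans := fun _ _ _ h1 h2 => h1.trans h2
        antisymm := by
          intro a b h1 h2
          by_contra hne'
          rcases Relation.reflTransGen_iff_eq_or_transGen.mp h1 with h | h
          · exact hne' h.symm
          · exact hac a (h.trans_left h2) }
    obtain ⟨L, hL, hle⟩ := extend_partialOrder (Relation.ReflTransGen G)
    have Ltr : ∀ a b d, L a b → L b d → L a d := fun a b d => hL.trans a b d
    have Las : ∀ a b, L a b → L b a → a = b := fun a b => hL.antisymm a b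
    have Ltot : ∀ a b, L a b ∨ L b a := fun a b => hL.total a b
    have hsub : ∀ a b, G a b → L a b := fun a b h => hle a b (Relation.ReflTransGen.single h)
    have key : ∀ s t, c s = c t → fA t < fA s → fB s ≠ fB t → L (fB t) (fB s) := by
      intro s t hc hA hB
      apply hsub
      refine ⟨c s, fun w hw => ⟨hB.symm, t, hc.symm, s, rfl, rfl, rfl, ?_⟩⟩
      have hst : s ≠ t := fun h => hB (by rw [h])
      rcases hw.total s rfl t hc.symm hst with h | h
      · exact absurd hA (hw.compat s rfl t hc.symm h)
      · exact h
    let e := Fintype.equivFin T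
    refine ⟨fun _ s t => (L (fB s) (fB t) ∧ fB s ≠ fB t) ∨
      (fB s = fB t ∧ (fA s < fA t ∨ (fA s = fA t ∧ e s < e t))), fun i => ?_, ?_⟩
    · constructor
      · intro s _ t _ hst
        by_cases hB : fB s = fB t
        · rcases lt_trichotomy (fA s) (fA t) with h | h | h
          · exact Or.inl (Or.inr ⟨hB, Or.inl h⟩)
          · rcases lt_trichotomy (e s) (e t) with h' | h' | h'
            · exact Or.inl (Or.inr ⟨hB, Or.inr ⟨h, h'⟩⟩)
            · exact absurd (e.injective h') hst
            · exact Or.inr (Or.inr ⟨hB.symm, Or.inr ⟨h.symm, h'⟩⟩)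
          · exact Or.inr (Or.inr ⟨hB.symm, Or.inl h⟩)
        · rcases Ltot (fB s) (fB t) with h | h
          · exact Or.inl (Or.inl ⟨h, hB⟩)
          · exact Or.inr (Or.inl ⟨h, Ne.symm hB⟩)
      · rintro s _ (⟨_, h⟩ | ⟨_, h | ⟨_, h⟩⟩)
        · exact h rfl
        · exact lt_irrefl _ h
        · exact lt_irrefl _ h
      · rintro s _ t _ u _ (⟨h1, n1⟩ | ⟨q1, h1⟩) (⟨h2, n2⟩ | ⟨q2, h2⟩)
        · refine Or.inl ⟨Ltr _ _ _ h1 h2, fun h => n1 (Las _ _ h1 ?_)⟩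
          rw [h]; exact h2
        · rw [← q2]; exact Or.inl ⟨h1, n1⟩
        · rw [q1]; exact Or.inl ⟨h2, n2⟩
        · refine Or.inr ⟨q1.trans q2, ?_⟩
          rcases h1 with h1 | ⟨h1, k1⟩ <;> rcases h2 with h2 | ⟨h2, k2⟩
          · exact Or.inl (h1.trans h2)
          · exact Or.inl (h2 ▸ h1)
          · exact Or.inl (h1 ▸ h2)
          · exact Or.inr ⟨h1.trans h2, k1.trans k2⟩
      · rintro s hs t ht (⟨h1, n1⟩ | ⟨q1, h1⟩) hlt
        · exact n1 (Las _ _ h1 (key s t (Eq.trans hs (Eq.symm ht)) hlt n1))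
        · rcases h1 with h1 | ⟨h1, _⟩
          · exact lt_asymm h1 hlt
          · exact absurd hlt (by rw [h1]; exact lt_irrefl _)
      · rintro s _ t _ u _ (⟨h1, n1⟩ | ⟨q1, _⟩) h2 hsu
        · rcases h2 with ⟨h2, n2⟩ | ⟨q2, _⟩
          · exact Las _ _ h1 (by rw [hsu]; exact h2)
          · exact hsu.trans q2.symm
        · exact q1
    · have hd : ∀ a b, Relation.TransGen (fun b b' => ∃ i : ι, derivedBOn fB {t | c t = i}
          (fun s t => (L (fB s) (fB t) ∧ fB s ≠ fB t) ∨
            (fB s = fB t ∧ (fA s < fA t ∨ (fA s = fA t ∧ e s < e t)))) b b') a b →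
          L a b ∧ a ≠ b := by
        have step : ∀ a b, (∃ i : ι, derivedBOn fB {t | c t = i}
          (fun s t => (L (fB s) (fB t) ∧ fB s ≠ fB t) ∨
            (fB s = fB t ∧ (fA s < fA t ∨ (fA s = fA t ∧ e s < e t)))) a b) →
            L a b ∧ a ≠ b := by
          rintro a b ⟨i, hab, s, _, t, _, rfl, rfl, h | ⟨h, _⟩⟩
          · exact h
          · exact absurd h hab
        intro a b h
        induction h with
        | single h => exact step _ _ h
        | tail _ h ih =>
          obtain ⟨h2, n2⟩ := step _ _ h
          refine ⟨Ltr _ _ _ ih.1 h2, fun h => ih.2 (Las _ _ ih.1 ?_)⟩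
          rw [h]; exact h2
      intro b hb
      exact (hd b b hb).2 rfl
end

section
/- Let r be a table over attributes A and B. The implicit-to-implicit candidate A* ~ B* is valid (i.e., a witness order exists) iff the graph BG' of r contains no 3-fan-out and no cycle. -/
/-- The co-occurrence bipartite graph `BG` of the table: left vertices are
A-values, right vertices are B-values, with an edge `{a, b}` whenever some
tuple has A-value `a` and B-value `b`. -/
def coGraph {T α β : Type*} (fA : T → α) (fB : T → β) : SimpleGraph (α ⊕ β) :=
  SimpleGraph.fromRel (fun v u => ∃ t : T, v = Sum.inl (fA t) ∧ u = Sum.inr (fB t))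

/-- A singleton: a vertex of degree 1 in `BG`. -/
def IsSingletonVtx {T α β : Type*} (fA : T → α) (fB : T → β) (v : α ⊕ β) : Prop :=
  ∃! u : α ⊕ β, (coGraph fA fB).Adj v u

/-- `BG'`: the graph obtained from `BG` by deleting all singletons together
with their incident edges. -/
def coGraph' {T α β : Type*} (fA : T → α) (fB : T → β) : SimpleGraph (α ⊕ β) :=
  SimpleGraph.fromRel (fun v u =>
    (coGraph fA fB).Adj v u ∧ ¬ IsSingletonVtx fA fB v ∧ ¬ IsSingletonVtx fA fB u)

/-- The graph contains no 3-fan-out: no vertex adjacent to at least three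
distinct vertices. -/
def NoThreeFanOut {V : Type*} (G : SimpleGraph V) : Prop :=
  ¬ ∃ v u₁ u₂ u₃ : V, u₁ ≠ u₂ ∧ u₁ ≠ u₃ ∧ u₂ ≠ u₃ ∧
      G.Adj v u₁ ∧ G.Adj v u₂ ∧ G.Adj v u₃

/-- A witness order for the implicit-to-implicit candidate `A* ~ B*`: a strict
linear order on the tuples under which both A-values and B-values form
intervals. -/
structure IsIIWitness {T α β : Type*} (fA : T → α) (fB : T → β)
    (w : T → T → Prop) : Prop where
  total : ∀ s t : T, s ≠ t → w s t ∨ w t s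
  irrefl : ∀ s : T, ¬ w s s
  trans : ∀ s t u : T, w s t → w t u → w s u
  intervalA : ∀ s t u : T, w s t → w t u → fA s = fA u → fA s = fA t
  intervalB : ∀ s t u : T, w s t → w t u → fB s = fB u → fB s = fB t


theorem aux_leaf {V : Type*} [Finite V] [Nonempty V] (H : SimpleGraph V) (hH : H.IsAcyclic) :
    ∃ v : V, ∀ x y, H.Adj v x → H.Adj v y → x = y := by
  classical
  have := Fintype.ofFinite V
  let P : ℕ → Prop := fun n => ∃ (u v : V) (p : H.Walk u v), p.IsPath ∧ p.length = n
  have h0 : P 0 := ⟨Classical.arbitrary V, _, SimpleGraph.Walk.nil, by simp, by simp⟩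
  have hg : P (Nat.findGreatest P (Fintype.card V)) := Nat.findGreatest_spec (Nat.zero_le _) h0
  obtain ⟨u, v, p, hp, hl⟩ := hg
  have key : ∀ x, H.Adj u x → x = p.snd := by
    intro x hx
    apply hH.eq_snd_of_adj_start hp hx
    by_contra hns
    have hq : (SimpleGraph.Walk.cons hx.symm p).IsPath := by
      rw [SimpleGraph.Walk.cons_isPath_iff]; exact ⟨hp, hns⟩
    have h1 := hq.length_lt
    have h2 : (SimpleGraph.Walk.cons hx.symm p).length ≤ Nat.findGreatest P (Fintype.card V) :=
      Nat.le_findGreatest h1.le ⟨_, _, _, hq, rfl⟩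
    simp at h2
    omega
  exact ⟨u, fun x y hx hy => (key x hx).trans (key y hy).symm⟩

theorem aux_path {V : Type*} (G : SimpleGraph V) (h3 : NoThreeFanOut G) (hG : G.IsAcyclic) :
    ∀ (n : ℕ) (S : Finset V), S.card = n → ∃ p : V → ℕ, (∀ x ∈ S, ∀ y ∈ S, p x = p y → x = y) ∧
      ∀ x ∈ S, ∀ y ∈ S, G.Adj x y → p x = p y + 1 ∨ p y = p x + 1 := by
  classical
  intro n
  induction n with
  | zero =>
    intro S hS
    rw [Finset.card_eq_zero] at hS
    subst hS
    exact ⟨fun _ => 0, by simp, by simp⟩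
  | succ n ih =>
    intro S hS
    have hne : Nonempty (S : Set V) := by
      have : S.Nonempty := by rw [← Finset.card_pos]; omega
      obtain ⟨x, hx⟩ := this
      exact ⟨⟨x, hx⟩⟩
    obtain ⟨⟨v, hv⟩, hleaf⟩ := aux_leaf _ (hG.induce (S : Set V))
    have hv : v ∈ S := hv
    have hleaf : ∀ x ∈ S, ∀ y ∈ S, G.Adj v x → G.Adj v y → x = y := by
      intro x hx y hy h1 h2
      have := hleaf ⟨x, hx⟩ ⟨y, hy⟩ (by simpa using h1) (by simpa using h2)
      simpa using this
    obtain ⟨p, hinj, hadj⟩ := ih (S.erase v) (by rw [Finset.card_erase_of_mem hv]; omega)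
    have hinj : ∀ x ∈ S, ∀ y ∈ S, x ≠ v → y ≠ v → p x = p y → x = y := fun x hx y hy h1 h2 =>
      hinj x (by simp [h1, hx]) y (by simp [h2, hy])
    have hadj : ∀ x ∈ S, ∀ y ∈ S, x ≠ v → y ≠ v → G.Adj x y →
        p x = p y + 1 ∨ p y = p x + 1 := fun x hx y hy h1 h2 =>
      hadj x (by simp [h1, hx]) y (by simp [h2, hy])
    by_cases hu : ∃ u ∈ S, G.Adj v u
    · obtain ⟨u, huS, huv⟩ := hu
      have huu : ∀ x ∈ S, G.Adj v x → x = u := fun x hx h => hleaf x hx u huS h huv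
      have huv' : u ≠ v := huv.ne'
      by_cases hc : ∃ w ∈ S, w ≠ v ∧ G.Adj u w ∧ p w = p u + 1
      · have hc2 : ∀ x ∈ S, x ≠ v → G.Adj u x → p x = p u + 1 := by
          obtain ⟨w, hw, hwv, huw, hpw⟩ := hc
          intro x hx hxv hux
          by_contra hcon
          exact h3 ⟨u, v, w, x, hwv.symm, hxv.symm, by rintro rfl; exact hcon hpw,
            huv.symm, huw, hux⟩
        refine ⟨fun x => if x = v then p u else if p u ≤ p x then p x + 1 else p x, ?_, ?_⟩
        · intro x hx y hy hxy
          have := hinj x hx y hy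
          dsimp only at hxy
          split_ifs at hxy <;> grind
        · intro x hx y hy hxy
          have h1 := hadj x hx y hy
          have h2 := hc2 x hx
          have h3 := hc2 y hy
          have h4 := huu x hx
          have h5 := huu y hy
          have h6 := hinj x hx u huS
          have h7 := hinj y hy u huS
          have h8 := hxy.symm
          have h9 := hxy.ne
          dsimp only
          split_ifs <;> grind
      · have hc2 : ∀ x ∈ S, x ≠ v → G.Adj u x → p u = p x + 1 := by
          intro x hx hxv hux
          rcases hadj u huS x hx huv' hxv hux with h | h
          · exact h
          · exact absurd ⟨x, hx, hxv, hux, h⟩ hc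
        refine ⟨fun x => if x = v then p u + 1 else if p u < p x then p x + 1 else p x, ?_, ?_⟩
        · intro x hx y hy hxy
          have := hinj x hx y hy
          dsimp only at hxy
          split_ifs at hxy <;> grind
        · intro x hx y hy hxy
          have h1 := hadj x hx y hy
          have h2 := hc2 x hx
          have h3 := hc2 y hy
          have h4 := huu x hx
          have h5 := huu y hy
          have h6 := hinj x hx u huS
          have h7 := hinj y hy u huS
          have h8 := hxy.symm
          have h9 := hxy.ne
          dsimp only
          split_ifs <;> grind
    · push Not at hu
      have hsup : ∀ x ∈ S, p x ≤ S.sup p := fun x hx => Finset.le_sup hx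
      refine ⟨fun x => if x = v then S.sup p + 1 else p x, ?_, ?_⟩
      · intro x hx y hy hxy
        have := hinj x hx y hy
        have := hsup x hx
        have := hsup y hy
        dsimp only at hxy
        split_ifs at hxy <;> grind
      · intro x hx y hy hxy
        have h1 := hadj x hx y hy
        have h4 := hu x hx
        have h5 := hu y hy
        have h8 := hxy.symm
        dsimp only
        split_ifs <;> grind

theorem coGraph_adj {T α β : Type*} (fA : T → α) (fB : T → β) (a : α) (v : α ⊕ β) :
    (coGraph fA fB).Adj (Sum.inl a) v ↔ ∃ t, fA t = a ∧ v = Sum.inr (fB t) := by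
  simp only [coGraph, SimpleGraph.fromRel_adj]
  constructor
  · rintro ⟨_, ⟨t, h1, h2⟩ | ⟨t, h1, h2⟩⟩
    · exact ⟨t, by simpa using h1.symm, h2⟩
    · simp at h2
  · rintro ⟨t, rfl, rfl⟩
    exact ⟨by simp, Or.inl ⟨t, rfl, rfl⟩⟩

theorem coGraph_adj_r {T α β : Type*} (fA : T → α) (fB : T → β) (b : β) (v : α ⊕ β) :
    (coGraph fA fB).Adj (Sum.inr b) v ↔ ∃ t, fB t = b ∧ v = Sum.inl (fA t) := by
  simp only [coGraph, SimpleGraph.fromRel_adj]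
  constructor
  · rintro ⟨_, ⟨t, h1, h2⟩ | ⟨t, h1, h2⟩⟩
    · simp at h1
    · exact ⟨t, by simpa using h2.symm, h1⟩
  · rintro ⟨t, rfl, rfl⟩
    exact ⟨by simp, Or.inr ⟨t, rfl, rfl⟩⟩

theorem coGraph'_adj {T α β : Type*} (fA : T → α) (fB : T → β) (u v : α ⊕ β) :
    (coGraph' fA fB).Adj u v ↔ (coGraph fA fB).Adj u v ∧
      ¬ IsSingletonVtx fA fB u ∧ ¬ IsSingletonVtx fA fB v := by
  simp only [coGraph', SimpleGraph.fromRel_adj]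
  constructor
  · rintro ⟨_, h | h⟩
    · exact h
    · exact ⟨h.1.symm, h.2.2, h.2.1⟩
  · intro h
    exact ⟨h.1.ne, Or.inl h⟩

theorem sing_l {T α β : Type*} (fA : T → α) (fB : T → β) (s : T) :
    IsSingletonVtx fA fB (Sum.inl (fA s)) ↔ ∀ t, fA t = fA s → fB t = fB s := by
  simp only [IsSingletonVtx, coGraph_adj]
  constructor
  · rintro ⟨u, _, h2⟩ t ht
    have h3 := h2 _ ⟨t, ht, rfl⟩
    have h4 := h2 _ ⟨s, rfl, rfl⟩
    simpa using h3.trans h4.symm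
  · intro h
    refine ⟨Sum.inr (fB s), ⟨s, rfl, rfl⟩, ?_⟩
    rintro y ⟨t, ht, rfl⟩
    rw [h t ht]

theorem sing_r {T α β : Type*} (fA : T → α) (fB : T → β) (s : T) :
    IsSingletonVtx fA fB (Sum.inr (fB s)) ↔ ∀ t, fB t = fB s → fA t = fA s := by
  simp only [IsSingletonVtx, coGraph_adj_r]
  constructor
  · rintro ⟨u, _, h2⟩ t ht
    have h3 := h2 _ ⟨t, ht, rfl⟩
    have h4 := h2 _ ⟨s, rfl, rfl⟩
    simpa using h3.trans h4.symm
  · intro h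
    refine ⟨Sum.inl (fA s), ⟨s, rfl, rfl⟩, ?_⟩
    rintro y ⟨t, ht, rfl⟩
    rw [h t ht]

/-- Three tuples sharing an `f`-value with distinct `g`-values, the middle one shared. -/
theorem fan_aux {T α β : Type*} (fA : T → α) (fB : T → β) (w : T → T → Prop)
    (hw : IsIIWitness fA fB w) (t1 t2 t3 s2 : T) (h12 : w t1 t2) (h23 : w t2 t3)
    (hA : fA t1 = fA t2) (hA' : fA t3 = fA t2) (hs : fB s2 = fB t2) (hsA : fA s2 ≠ fA t2)
    (hb1 : fB t1 ≠ fB t2) (hb3 : fB t3 ≠ fB t2) : False := by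
  have n1 : s2 ≠ t1 := by rintro rfl; exact hsA hA
  have n3 : s2 ≠ t3 := by rintro rfl; exact hsA hA'
  rcases hw.total s2 t1 n1 with h | h
  · exact hb1 ((hw.intervalB s2 t1 t2 h h12 hs).symm.trans hs)
  · rcases hw.total s2 t3 n3 with h' | h'
    · exact hsA ((hw.intervalA t1 s2 t3 h h' (hA.trans hA'.symm)).symm.trans hA)
    · exact hb3 (hw.intervalB t2 t3 s2 h23 h' hs.symm).symm

theorem fan_aux2 {T α β : Type*} (fA : T → α) (fB : T → β) (w : T → T → Prop)
    (hw : IsIIWitness fA fB w) (a : α) (t1 t2 t3 s1 s2 s3 : T)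
    (a1 : fA t1 = a) (a2 : fA t2 = a) (a3 : fA t3 = a)
    (e1 : fB s1 = fB t1) (e2 : fB s2 = fB t2) (e3 : fB s3 = fB t3)
    (n1 : fA s1 ≠ a) (n2 : fA s2 ≠ a) (n3 : fA s3 ≠ a)
    (d12 : fB t1 ≠ fB t2) (d13 : fB t1 ≠ fB t3) (d23 : fB t2 ≠ fB t3) : False := by
  have key := fan_aux fA fB w hw
  have k12 := hw.total t1 t2 (by rintro rfl; exact d12 rfl)
  have k13 := hw.total t1 t3 (by rintro rfl; exact d13 rfl)
  have k23 := hw.total t2 t3 (by rintro rfl; exact d23 rfl)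
  have := key t1 t2 t3 s2
  have := key t3 t2 t1 s2
  have := key t2 t1 t3 s1
  have := key t3 t1 t2 s1
  have := key t1 t3 t2 s3
  have := key t2 t3 t1 s3
  grind

theorem IsIIWitness.swap {T α β : Type*} {fA : T → α} {fB : T → β} {w : T → T → Prop}
    (hw : IsIIWitness fA fB w) : IsIIWitness fB fA w :=
  ⟨hw.total, hw.irrefl, hw.trans, hw.intervalB, hw.intervalA⟩

theorem witness_fan {T α β : Type*} (fA : T → α) (fB : T → β) (w : T → T → Prop)
    (hw : IsIIWitness fA fB w) : NoThreeFanOut (coGraph' fA fB) := by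
  rintro ⟨v, u1, u2, u3, d12, d13, d23, h1, h2, h3⟩
  rw [coGraph'_adj] at h1 h2 h3
  obtain ⟨h1, _, g1⟩ := h1
  obtain ⟨h2, _, g2⟩ := h2
  obtain ⟨h3, _, g3⟩ := h3
  rcases v with a | b
  · rw [coGraph_adj] at h1 h2 h3
    obtain ⟨t1, a1, rfl⟩ := h1
    obtain ⟨t2, a2, rfl⟩ := h2
    obtain ⟨t3, a3, rfl⟩ := h3
    rw [sing_r] at g1 g2 g3
    push Not at g1 g2 g3
    obtain ⟨s1, e1, n1⟩ := g1
    obtain ⟨s2, e2, n2⟩ := g2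
    obtain ⟨s3, e3, n3⟩ := g3
    exact fan_aux2 fA fB w hw a t1 t2 t3 s1 s2 s3 a1 a2 a3 e1 e2 e3 (a1 ▸ n1) (a2 ▸ n2) (a3 ▸ n3)
      (by simpa using d12) (by simpa using d13) (by simpa using d23)
  · rw [coGraph_adj_r] at h1 h2 h3
    obtain ⟨t1, a1, rfl⟩ := h1
    obtain ⟨t2, a2, rfl⟩ := h2
    obtain ⟨t3, a3, rfl⟩ := h3
    rw [sing_l] at g1 g2 g3
    push Not at g1 g2 g3
    obtain ⟨s1, e1, n1⟩ := g1
    obtain ⟨s2, e2, n2⟩ := g2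
    obtain ⟨s3, e3, n3⟩ := g3
    exact fan_aux2 fB fA w hw.swap b t1 t2 t3 s1 s2 s3 a1 a2 a3 e1 e2 e3
      (a1 ▸ n1) (a2 ▸ n2) (a3 ▸ n3)
      (by simpa using d12) (by simpa using d13) (by simpa using d23)

theorem exists_max_of_witness {T α β : Type*} [Finite T] (fA : T → α) (fB : T → β)
    (w : T → T → Prop) (hw : IsIIWitness fA fB w) (S : Set T) (hS : S.Nonempty) :
    ∃ m ∈ S, ∀ t ∈ S, t ≠ m → w t m := by
  have : IsStrictOrder T (Function.swap w) :=
    { irrefl := hw.irrefl, trans := fun a b c h1 h2 => hw.trans c b a h2 h1 }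
  have wf : WellFounded (Function.swap w) := Finite.wellFounded_of_trans_of_irrefl _
  obtain ⟨m, hm, h⟩ := wf.has_min S hS
  refine ⟨m, hm, fun t ht hne => ?_⟩
  rcases hw.total t m hne with h' | h'
  · exact h'
  · exact absurd h' (h t ht)

theorem witness_acyclic {T α β : Type*} [Finite T] (fA : T → α) (fB : T → β) (w : T → T → Prop)
    (hw : IsIIWitness fA fB w) : (coGraph' fA fB).IsAcyclic := by
  intro v c hc
  let K := c.toSubgraph
  have hK : ∀ x y, K.Adj x y → (coGraph fA fB).Adj x y := fun x y h =>
    ((coGraph'_adj fA fB x y).1 h.adj_sub).1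
  have htwo : ∀ x y, K.Adj x y → ∃ z, z ≠ y ∧ K.Adj x z := by
    intro x y hxy
    have h2 : (K.neighborSet x).ncard = 2 := hc.ncard_neighborSet_toSubgraph_eq_two (v := x)
      (c.mem_verts_toSubgraph.mp (K.edge_vert hxy))
    obtain ⟨z, hz, hzy⟩ := Set.exists_ne_of_one_lt_ncard (by omega : 1 < (K.neighborSet x).ncard) y
    exact ⟨z, hzy, hz⟩
  have hne : {t | K.Adj (Sum.inl (fA t)) (Sum.inr (fB t))}.Nonempty := by
    have h2 : (K.neighborSet v).ncard = 2 := hc.ncard_neighborSet_toSubgraph_eq_two (v := v) (by simp)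
    have : (K.neighborSet v).Nonempty := by
      apply Set.nonempty_of_ncard_ne_zero; omega
    obtain ⟨z, hz⟩ := this
    have hz : K.Adj v z := hz
    have hz' := hK _ _ hz
    rcases v with a | b
    · rw [coGraph_adj] at hz'
      obtain ⟨t, rfl, rfl⟩ := hz'
      exact ⟨t, hz⟩
    · rw [coGraph_adj_r] at hz'
      obtain ⟨t, rfl, rfl⟩ := hz'
      exact ⟨t, hz.symm⟩
  obtain ⟨m, hm, hmax⟩ := exists_max_of_witness fA fB w hw _ hne
  have hm : K.Adj (Sum.inl (fA m)) (Sum.inr (fB m)) := hm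
  obtain ⟨z1, hz1, hk1⟩ := htwo _ _ hm
  obtain ⟨z2, hz2, hk2⟩ := htwo _ _ hm.symm
  obtain ⟨t1, ht1, rfl⟩ := (coGraph_adj fA fB _ _).1 (hK _ _ hk1)
  obtain ⟨t2, ht2, rfl⟩ := (coGraph_adj_r fA fB _ _).1 (hK _ _ hk2)
  have hb : fB t1 ≠ fB m := by simpa using hz1
  have ha : fA t2 ≠ fA m := by simpa using hz2
  have w1 := hmax t1 (by rw [← ht1] at hk1; exact hk1) (by rintro rfl; exact hb rfl)
  have w2 := hmax t2 (by rw [← ht2] at hk2; exact hk2.symm) (by rintro rfl; exact ha rfl)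
  rcases hw.total t1 t2 (by rintro rfl; exact hb ht2) with h | h
  · exact ha ((hw.intervalA t1 t2 m h w2 ht1).symm.trans ht1)
  · exact hb ((hw.intervalB t2 t1 m h w1 ht2).symm.trans ht2)

theorem exists_witness_s5 {T α β : Type*} [Finite T] (fA : T → α) (fB : T → β)
    (h3 : NoThreeFanOut (coGraph' fA fB)) (hG : (coGraph' fA fB).IsAcyclic) :
    ∃ w : T → T → Prop, IsIIWitness fA fB w := by
  classical
  have := Fintype.ofFinite T
  obtain ⟨p, hinj, hadj⟩ := aux_path _ h3 hG _
    (Finset.univ.image (fun t => (Sum.inl (fA t) : α ⊕ β)) ∪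
      Finset.univ.image (fun t => (Sum.inr (fB t) : α ⊕ β))) rfl
  have iA : ∀ s t, p (Sum.inl (fA s)) = p (Sum.inl (fA t)) → fA s = fA t := fun s t h => by
    simpa using hinj _ (by simp) _ (by simp) h
  have iB : ∀ s t, p (Sum.inr (fB s)) = p (Sum.inr (fB t)) → fB s = fB t := fun s t h => by
    simpa using hinj _ (by simp) _ (by simp) h
  have iAB : ∀ s t, p (Sum.inl (fA s)) ≠ p (Sum.inr (fB t)) := fun s t h => by
    simpa using hinj _ (by simp) _ (by simp) h
  have hE : ∀ t, ¬ IsSingletonVtx fA fB (Sum.inl (fA t)) → ¬ IsSingletonVtx fA fB (Sum.inr (fB t)) →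
      p (Sum.inl (fA t)) = p (Sum.inr (fB t)) + 1 ∨ p (Sum.inr (fB t)) = p (Sum.inl (fA t)) + 1 := by
    intro t h1 h2
    exact hadj _ (by simp) _ (by simp) ((coGraph'_adj _ _ _ _).2
      ⟨(coGraph_adj _ _ _ _).2 ⟨t, rfl, rfl⟩, h1, h2⟩)
  clear hinj hadj
  obtain ⟨e, he⟩ := exists_injective_nat T
  obtain ⟨g, hg⟩ := exists_injective_nat (Set.range fun t => (fA t, fB t))
  obtain ⟨rk, hrk⟩ : ∃ rk : T → ℕ, ∀ s t, rk s = rk t ↔ (fA s = fA t ∧ fB s = fB t) :=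
    ⟨fun t => g ⟨(fA t, fB t), t, rfl⟩, fun s t => by simp [hg.eq_iff, Subtype.ext_iff]⟩
  obtain ⟨key, hkey⟩ : ∃ key : T → ℕ, ∀ t, key t =
      if IsSingletonVtx fA fB (Sum.inr (fB t)) then 2 * p (Sum.inl (fA t))
      else if IsSingletonVtx fA fB (Sum.inl (fA t)) then 2 * p (Sum.inr (fB t))
      else p (Sum.inl (fA t)) + p (Sum.inr (fB t)) := ⟨_, fun _ => rfl⟩
  have hsame : ∀ s t, fA s = fA t → fB s = fB t → key s = key t := by
    intro s t h1 h2
    rw [hkey, hkey, h1, h2]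
  have kA : ∀ s, ¬ IsSingletonVtx fA fB (Sum.inl (fA s)) →
      key s ≤ 2 * p (Sum.inl (fA s)) + 1 ∧ 2 * p (Sum.inl (fA s)) ≤ key s + 1 := by
    intro s hs
    have ks := hkey s
    by_cases hb : IsSingletonVtx fA fB (Sum.inr (fB s))
    · rw [if_pos hb] at ks
      omega
    · rw [if_neg hb, if_neg hs] at ks
      have := hE s hs hb
      omega
  have kB : ∀ s, ¬ IsSingletonVtx fA fB (Sum.inr (fB s)) →
      key s ≤ 2 * p (Sum.inr (fB s)) + 1 ∧ 2 * p (Sum.inr (fB s)) ≤ key s + 1 := by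
    intro s hs
    have ks := hkey s
    rw [if_neg hs] at ks
    by_cases ha : IsSingletonVtx fA fB (Sum.inl (fA s))
    · rw [if_pos ha] at ks
      omega
    · rw [if_neg ha] at ks
      have := hE s ha hs
      omega
  have kT : ∀ t, key t = 2 * p (Sum.inl (fA t)) ∨ key t = 2 * p (Sum.inr (fB t)) ∨
      (key t = p (Sum.inl (fA t)) + p (Sum.inr (fB t)) ∧
      (p (Sum.inl (fA t)) = p (Sum.inr (fB t)) + 1 ∨
        p (Sum.inr (fB t)) = p (Sum.inl (fA t)) + 1)) := by
    intro t
    have kt := hkey t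
    split_ifs at kt with hb ha
    · exact Or.inl kt
    · exact Or.inr (Or.inl kt)
    · exact Or.inr (Or.inr ⟨kt, hE t ha hb⟩)
  refine ⟨fun s t => key s < key t ∨ key s = key t ∧ (rk s < rk t ∨ rk s = rk t ∧ e s < e t),
    ?_, ?_, ?_, ?_, ?_⟩
  · intro s t hst
    have : e s ≠ e t := fun h => hst (he h)
    omega
  · intro s
    omega
  · intro s t u h1 h2
    omega
  · intro s t u h1 h2 hsu
    by_cases hs : IsSingletonVtx fA fB (Sum.inl (fA s))
    · have hB := (sing_l fA fB s).1 hs u hsu.symm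
      have hk := hsame s u hsu hB.symm
      have hr := (hrk s u).2 ⟨hsu, hB.symm⟩
      exact ((hrk s t).1 (by omega)).1
    · have hu : ¬ IsSingletonVtx fA fB (Sum.inl (fA u)) := hsu ▸ hs
      have ks := kA s hs
      have ku := kA u hu
      have kt := kT t
      have ist' := iAB s t
      rw [← hsu] at ku
      apply iA s t
      omega
  · intro s t u h1 h2 hsu
    by_cases hs : IsSingletonVtx fA fB (Sum.inr (fB s))
    · have hA := (sing_r fA fB s).1 hs u hsu.symm
      have hk := hsame s u hA.symm hsu
      have hr := (hrk s u).2 ⟨hA.symm, hsu⟩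
      exact ((hrk s t).1 (by omega)).2
    · have hu : ¬ IsSingletonVtx fA fB (Sum.inr (fB u)) := hsu ▸ hs
      have ks := kB s hs
      have ku := kB u hu
      have kt := kT t
      have ist' := iAB t s
      rw [← hsu] at ku
      apply iB s t
      omega

/-- The implicit-to-implicit candidate `A* ~ B*` is valid iff the graph `BG'`
contains no 3-fan-out and no cycle. -/
theorem stmt5 {T α β : Type*} [Fintype T] [Nonempty T] (fA : T → α) (fB : T → β) :
    (∃ w : T → T → Prop, IsIIWitness fA fB w) ↔
      (NoThreeFanOut (coGraph' fA fB) ∧ (coGraph' fA fB).IsAcyclic) := by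
  constructor
  · rintro ⟨w, hw⟩
    exact ⟨witness_fan fA fB w hw, witness_acyclic fA fB w hw⟩
  · rintro ⟨h3, hG⟩
    exact exists_witness_s5 fA fB h3 hG
end

section
/- Let r be a table over attributes A and B that contains (among possibly other tuples) tuples with (A,B)-values (a_1,b_1), (a_2,b_2), (a_3,b_3), (a_4,b_1), (a_4,b_2), (a_4,b_3), where a_1, a_2, a_3, a_4 are pairwise distinct A-values and b_1, b_2, b_3 are pairwise distinct B-values. Then no witness order for the implicit-to-implicit candidate A* ~ B* exists, i.e., the candidate is invalid over r. -/
theorem mid_false {T α β : Type*} {fA : T → α} {fB : T → β} {w : T → T → Prop}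
    (h : IsIIWitness fA fB w) (x p q r : T) (hpq : w p q) (hqr : w q r)
    (hA : fA p = fA r) (hx : fA x ≠ fA p) (hB : fB x = fB q)
    (hp : fB p ≠ fB q) (hr : fB r ≠ fB q) : False := by
  have hxp : x ≠ p := fun e => hx (by rw [e])
  have hxr : x ≠ r := fun e => hx (by rw [e, hA])
  rcases h.total x p hxp with h1 | h1
  · exact hp ((h.intervalB x p q h1 hpq hB).symm.trans hB)
  · rcases h.total x r hxr with h2 | h2
    · exact hx (h.intervalA p x r h1 h2 hA).symm
    · exact hr (h.intervalB q r x hqr h2 hB.symm).symm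

/-- If the table contains (among possibly other tuples) tuples with
(A,B)-values `(a₁,b₁), (a₂,b₂), (a₃,b₃), (a₄,b₁), (a₄,b₂), (a₄,b₃)` with
`a₁, a₂, a₃, a₄` pairwise distinct and `b₁, b₂, b₃` pairwise distinct
(a 3-fan-out at `a₄`), then no witness order for the candidate `A* ~ B*`
exists. -/
theorem stmt6 {T α β : Type*} [Fintype T] (fA : T → α) (fB : T → β)
    (a₁ a₂ a₃ a₄ : α) (b₁ b₂ b₃ : β)
    (ha₁₂ : a₁ ≠ a₂) (ha₁₃ : a₁ ≠ a₃) (ha₁₄ : a₁ ≠ a₄)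
    (ha₂₃ : a₂ ≠ a₃) (ha₂₄ : a₂ ≠ a₄) (ha₃₄ : a₃ ≠ a₄)
    (hb₁₂ : b₁ ≠ b₂) (hb₁₃ : b₁ ≠ b₃) (hb₂₃ : b₂ ≠ b₃)
    (h₁ : ∃ t : T, fA t = a₁ ∧ fB t = b₁)
    (h₂ : ∃ t : T, fA t = a₂ ∧ fB t = b₂)
    (h₃ : ∃ t : T, fA t = a₃ ∧ fB t = b₃)
    (h₄ : ∃ t : T, fA t = a₄ ∧ fB t = b₁)
    (h₅ : ∃ t : T, fA t = a₄ ∧ fB t = b₂)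
    (h₆ : ∃ t : T, fA t = a₄ ∧ fB t = b₃) :
    ¬ ∃ w : T → T → Prop, IsIIWitness fA fB w := by
  rintro ⟨w, h⟩
  obtain ⟨x1, hx1, hx1'⟩ := h₁
  obtain ⟨x2, hx2, hx2'⟩ := h₂
  obtain ⟨x3, hx3, hx3'⟩ := h₃
  obtain ⟨y1, hy1, hy1'⟩ := h₄
  obtain ⟨y2, hy2, hy2'⟩ := h₅
  obtain ⟨y3, hy3, hy3'⟩ := h₆
  have m1 := mid_false h x1
  have m2 := mid_false h x2
  have m3 := mid_false h x3
  have t12 := h.total y1 y2 (by rintro rfl; exact hb₁₂ (hy1'.symm.trans hy2'))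
  have t13 := h.total y1 y3 (by rintro rfl; exact hb₁₃ (hy1'.symm.trans hy3'))
  have t23 := h.total y2 y3 (by rintro rfl; exact hb₂₃ (hy2'.symm.trans hy3'))
  have a1 := m1 y2 y1 y3
  have a2 := m1 y3 y1 y2
  have a3 := m2 y1 y2 y3
  have a4 := m2 y3 y2 y1
  have a5 := m3 y1 y3 y2
  have a6 := m3 y2 y3 y1
  clear m1 m2 m3 h
  subst hx1 hx2 hx3
  grind
end

section
/- Let r be a table over attributes A and B that contains, for some k ≥ 2, tuples with (A,B)-values (a_1,b_1), (a_2,b_1), (a_2,b_2), (a_3,b_2), ..., (a_k,b_{k-1}), (a_k,b_k), (a_1,b_k), where a_1, ..., a_k are pairwise distinct A-values and b_1, ..., b_k are pairwise distinct B-values (so the co-occurrence bipartite graph of r contains a cycle through these values). Then no witness order for the implicit-to-implicit candidate A* ~ B* exists, i.e., the candidate is invalid over r. -/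
theorem witness_no_corner {T α β : Type*} {fA : T → α} {fB : T → β} {w : T → T → Prop}
    (h : IsIIWitness fA fB w) {m p q : T} (hp : fA m = fA p) (hq : fB m = fB q)
    (hp' : fB m ≠ fB p) (hq' : fA m ≠ fA q) (h1 : ¬ w p m) (h2 : ¬ w q m) : False := by
  have mp : w m p := (h.total m p (fun e => hp' (by rw [e]))).resolve_right h1
  have mq : w m q := (h.total m q (fun e => hq' (by rw [e]))).resolve_right h2
  rcases h.total p q (fun e => hq' (by rw [← e, hp])) with c | c
  · exact hp' (h.intervalB m p q mp c hq)
  · exact hq' (h.intervalA m q p mq c hp)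

/-- If the table contains, for some `k ≥ 2`, tuples with (A,B)-values
`(a₀,b₀), (a₁,b₀), (a₁,b₁), (a₂,b₁), ..., (a_{k-1},b_{k-2}),
(a_{k-1},b_{k-1}), (a₀,b_{k-1})` (indices `0, ..., k-1`), with
`a₀, ..., a_{k-1}` pairwise distinct and `b₀, ..., b_{k-1}` pairwise distinct
(so the co-occurrence bipartite graph contains a cycle through these values),
then no witness order for the candidate `A* ~ B*` exists. -/
theorem stmt7 {T α β : Type*} [Fintype T] (fA : T → α) (fB : T → β)
    (k : ℕ) (hk : 2 ≤ k) (a : ℕ → α) (b : ℕ → β)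
    (ha : ∀ i < k, ∀ j < k, i ≠ j → a i ≠ a j)
    (hb : ∀ i < k, ∀ j < k, i ≠ j → b i ≠ b j)
    (hdiag : ∀ i < k, ∃ t : T, fA t = a i ∧ fB t = b i)
    (hsucc : ∀ i : ℕ, i + 1 < k → ∃ t : T, fA t = a (i + 1) ∧ fB t = b i)
    (hwrap : ∃ t : T, fA t = a 0 ∧ fB t = b (k - 1)) :
    ¬ ∃ w : T → T → Prop, IsIIWitness fA fB w := by
  rintro ⟨w, h⟩
  have hS : ∀ i < k, ∃ t : T, fA t = a ((i + 1) % k) ∧ fB t = b i := by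
    intro i hi
    by_cases hc : i + 1 < k
    · rw [Nat.mod_eq_of_lt hc]; exact hsucc i hc
    · have e : i + 1 = k := by omega
      have e' : i = k - 1 := by omega
      rw [e, Nat.mod_self, e']; exact hwrap
  have hne : ∀ i < k, (i + 1) % k ≠ i ∧ (i + 1) % k < k := by
    intro i hi
    refine ⟨?_, Nat.mod_lt _ (by omega)⟩
    by_cases hc : i + 1 < k
    · rw [Nat.mod_eq_of_lt hc]; omega
    · have e : i + 1 = k := by omega
      rw [e, Nat.mod_self]; omega
  have hpred : ∀ i < k, ∃ j < k, (j + 1) % k = i := by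
    intro i hi
    rcases i with _ | i
    · exact ⟨k - 1, by omega, by rw [Nat.sub_add_cancel (by omega), Nat.mod_self]⟩
    · exact ⟨i, by omega, Nat.mod_eq_of_lt hi⟩
  let P : Set T := {t | ∃ i < k, fB t = b i ∧ (fA t = a i ∨ fA t = a ((i + 1) % k))}
  haveI : IsTrans T w := ⟨h.trans⟩
  haveI : Std.Irrefl w := ⟨h.irrefl⟩
  have wf : WellFounded w := Finite.wellFounded_of_trans_of_irrefl w
  obtain ⟨m, ⟨i, hi, hmB, hmA⟩, hmin⟩ := wf.has_min P (by
    obtain ⟨t, h1, h2⟩ := hdiag 0 (by omega)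
    exact ⟨t, 0, by omega, h2, Or.inl h1⟩)
  rcases hmA with hmA | hmA
  · obtain ⟨j, hj, hji⟩ := hpred i hi
    obtain ⟨p, pA, pB⟩ := hS j hj
    obtain ⟨q, qA, qB⟩ := hS i hi
    have hij : i ≠ j := by
      rintro rfl
      exact (hne i hi).1 hji
    refine witness_no_corner h (m := m) (p := p) (q := q) (by rw [hmA, pA, hji])
      (by rw [hmB, qB]) ?_ ?_ (hmin p ⟨j, hj, pB, Or.inr pA⟩) (hmin q ⟨i, hi, qB, Or.inr qA⟩)
    · rw [hmB, pB]; exact hb i hi j hj hij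
    · rw [hmA, qA]; exact ha i hi _ (hne i hi).2 (hne i hi).1.symm
  · obtain ⟨hn, hl⟩ := hne i hi
    obtain ⟨p, pA, pB⟩ := hdiag _ hl
    obtain ⟨q, qA, qB⟩ := hdiag i hi
    refine witness_no_corner h (m := m) (p := p) (q := q) (by rw [hmA, pA])
      (by rw [hmB, qB]) ?_ ?_ (hmin p ⟨_, hl, pB, Or.inl pA⟩) (hmin q ⟨i, hi, qB, Or.inl qA⟩)
    · rw [hmB, pB]; exact hb i hi _ hl hn.symm
    · rw [hmA, qA]; exact ha _ hl i hi hn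
end

section
/- Let φ be a NAE-3SAT instance with propositions p_1, ..., p_m and clauses C_1, ..., C_n, where clause C_i consists of literals L_{i,1}, L_{i,2}, L_{i,3}. Construct the CPP instance over the elements {t_k, f_k : 1 ≤ k ≤ m} ∪ {a_i, b_i, c_i : 1 ≤ i ≤ n} containing, for each clause C_i, the three lists [X_{i,1}, a_i, b_i, Y_{i,1}], [X_{i,2}, b_i, c_i, Y_{i,2}], [X_{i,3}, c_i, a_i, Y_{i,3}], where (X_{i,j}, Y_{i,j}) = (t_k, f_k) if L_{i,j} is the positive literal p_k and (X_{i,j}, Y_{i,j}) = (f_k, t_k) if L_{i,j} is the negated literal ¬p_k. Then this CPP instance has a polarization admitting a strong partial order iff φ is NAE-satisfiable. -/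
/-- Elements of the CPP instance of the NAE-3SAT reduction: the propositional
elements `t_k = inl (k, true)` and `f_k = inl (k, false)`, and the confounder
elements `a_i = inr (i, 0)`, `b_i = inr (i, 1)`, `c_i = inr (i, 2)`. -/
abbrev CPPElem (m n : ℕ) := (Fin m × Bool) ⊕ (Fin n × Fin 3)

/-- The order pairs implied by a list: `x ≺ y` for each pair of consecutive
elements `x, y` of the list. -/
def listPairs {E : Type*} (l : List E) (x y : E) : Prop :=
  ∃ u v : List E, l = u ++ x :: y :: v

/-- A NAE-3SAT instance: clause `i` consists of the three literals
`C i 0, C i 1, C i 2`, where the literal `(k, true)` is the positive literal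
`p_k` and `(k, false)` is the negated literal `¬ p_k`. -/
def NAESatisfiable {m n : ℕ} (C : Fin n → Fin 3 → Fin m × Bool) : Prop :=
  ∃ σ : Fin m → Bool, ∀ i : Fin n,
    (∃ j : Fin 3, σ (C i j).1 = (C i j).2) ∧ (∃ j : Fin 3, σ (C i j).1 ≠ (C i j).2)

/-- The `j`-th list of the gadget for clause `i`:
`[X_{i,1}, a_i, b_i, Y_{i,1}]`, `[X_{i,2}, b_i, c_i, Y_{i,2}]`,
`[X_{i,3}, c_i, a_i, Y_{i,3}]`, where `(X_{i,j}, Y_{i,j}) = (t_k, f_k)` if the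
literal `L_{i,j}` is `p_k` and `(f_k, t_k)` if it is `¬ p_k`. -/
def gadgetList {m n : ℕ} (C : Fin n → Fin 3 → Fin m × Bool) (i : Fin n) (j : Fin 3) :
    List (CPPElem m n) :=
  [Sum.inl (C i j), Sum.inr (i, j), Sum.inr (i, j + 1),
   Sum.inl ((C i j).1, !(C i j).2)]

/-- The union of the order pairs implied by the lists of the polarization
determined by `pol` (list `(i, j)` is reversed iff `pol i j = true`). -/
def polPairs {m n : ℕ} (C : Fin n → Fin 3 → Fin m × Bool)
    (pol : Fin n → Fin 3 → Bool) (x y : CPPElem m n) : Prop :=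
  ∃ (i : Fin n) (j : Fin 3),
    listPairs (if pol i j then (gadgetList C i j).reverse else gadgetList C i j) x y

theorem listPairs_four {E : Type*} (a b c d x y : E) :
    listPairs [a, b, c, d] x y ↔ (x = a ∧ y = b) ∨ (x = b ∧ y = c) ∨ (x = c ∧ y = d) := by
  constructor
  · rintro ⟨u, v, h⟩
    rcases u with _ | ⟨u1, _ | ⟨u2, _ | ⟨u3, _ | ⟨u4, u⟩⟩⟩⟩ <;> simp at h <;> grind
  · rintro (⟨rfl, rfl⟩ | ⟨rfl, rfl⟩ | ⟨rfl, rfl⟩)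
    · exact ⟨[], [c, d], rfl⟩
    · exact ⟨[a], [d], rfl⟩
    · exact ⟨[a, b], [], rfl⟩

theorem polPairs_fwd {m n : ℕ} (C : Fin n → Fin 3 → Fin m × Bool)
    (pol : Fin n → Fin 3 → Bool) (i : Fin n) (j : Fin 3) (h : pol i j = false) :
    polPairs C pol (Sum.inl (C i j)) (Sum.inr (i, j)) ∧
    polPairs C pol (Sum.inr (i, j)) (Sum.inr (i, j + 1)) ∧
    polPairs C pol (Sum.inr (i, j + 1)) (Sum.inl ((C i j).1, !(C i j).2)) := by
  refine ⟨⟨i, j, ?_⟩, ⟨i, j, ?_⟩, ⟨i, j, ?_⟩⟩ <;>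
    simp [h, gadgetList, listPairs_four]

theorem polPairs_bwd {m n : ℕ} (C : Fin n → Fin 3 → Fin m × Bool)
    (pol : Fin n → Fin 3 → Bool) (i : Fin n) (j : Fin 3) (h : pol i j = true) :
    polPairs C pol (Sum.inl ((C i j).1, !(C i j).2)) (Sum.inr (i, j + 1)) ∧
    polPairs C pol (Sum.inr (i, j + 1)) (Sum.inr (i, j)) ∧
    polPairs C pol (Sum.inr (i, j)) (Sum.inl (C i j)) := by
  refine ⟨⟨i, j, ?_⟩, ⟨i, j, ?_⟩, ⟨i, j, ?_⟩⟩ <;>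
    simp [h, gadgetList, listPairs_four]

/-- Rank function witnessing acyclicity: `v i j` says literal `j` of clause `i` is true. -/
def gadgetRank {m n : ℕ} (σ : Fin m → Bool) (v : Fin n → Fin 3 → Bool) : CPPElem m n → ℕ
  | Sum.inl (k, b) => if b = σ k then 0 else 4
  | Sum.inr (i, j) => 1 + (if v i (j + 2) then 1 else 0) + (if v i j then 0 else 1)

theorem gadgetRank_lt {m n : ℕ} (C : Fin n → Fin 3 → Fin m × Bool) (σ : Fin m → Bool)
    (hσ : ∀ i : Fin n,
      (∃ j : Fin 3, σ (C i j).1 = (C i j).2) ∧ (∃ j : Fin 3, σ (C i j).1 ≠ (C i j).2))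
    (x y : CPPElem m n)
    (h : polPairs C (fun i j => !decide (σ (C i j).1 = (C i j).2)) x y) :
    gadgetRank σ (fun i j => decide (σ (C i j).1 = (C i j).2)) x <
      gadgetRank σ (fun i j => decide (σ (C i j).1 = (C i j).2)) y := by
  obtain ⟨i, j, h⟩ := h
  have hv : ∃ v : Fin n → Fin 3 → Bool,
    v = (fun i j => decide (σ (C i j).1 = (C i j).2)) := ⟨_, rfl⟩
  obtain ⟨v, hv⟩ := hv
  have hvij : v i j = decide (σ (C i j).1 = (C i j).2) := by rw [hv]
  have h1 : ∃ j, v i j = true := by simpa [hv] using (hσ i).1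
  have h2 : ∃ j, v i j = false := by simpa [hv] using (hσ i).2
  have e1 : j + 1 + 2 = j := by clear * -; revert j; decide
  have h1' : v i j = true ∨ v i (j + 1) = true ∨ v i (j + 2) = true := by
    obtain ⟨k, hk⟩ := h1
    have : k = j ∨ k = j + 1 ∨ k = j + 2 := by clear * -; revert k j; decide
    rcases this with rfl | rfl | rfl <;> simp [hk]
  have h2' : v i j = false ∨ v i (j + 1) = false ∨ v i (j + 2) = false := by
    obtain ⟨k, hk⟩ := h2
    have : k = j ∨ k = j + 1 ∨ k = j + 2 := by clear * -; revert k j; decide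
    rcases this with rfl | rfl | rfl <;> simp [hk]
  rw [← hv]
  simp only [← hvij] at h
  rcases hC : C i j with ⟨k, b⟩
  rw [hC] at hvij
  simp only [gadgetList, hC] at h
  cases hb : v i j
  · have hk : b = !σ k := by
      rw [hb] at hvij
      simp at hvij
      cases b <;> simp_all
    simp only [hb, Bool.not_false, if_true, List.reverse_cons, List.reverse_nil, List.nil_append,
      List.cons_append, listPairs_four] at h
    rcases h with ⟨rfl, rfl⟩ | ⟨rfl, rfl⟩ | ⟨rfl, rfl⟩
    · simp [gadgetRank, hk]
    · simp only [gadgetRank, e1, hb]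
      grind
    · simp only [gadgetRank, hk, hb]
      grind
  · have hk : b = σ k := by
      rw [hb] at hvij
      simp at hvij
      exact hvij.symm
    simp only [hb, Bool.not_true, Bool.false_eq_true, if_false, listPairs_four] at h
    rcases h with ⟨rfl, rfl⟩ | ⟨rfl, rfl⟩ | ⟨rfl, rfl⟩
    · simp [gadgetRank, hk]
    · simp only [gadgetRank, e1, hb]
      grind
    · simp only [gadgetRank, hk, e1, hb]
      grind

/-- The CPP instance constructed from a NAE-3SAT instance has a polarization
admitting a strong partial order (equivalently, one whose implied order pairs
have an irreflexive transitive closure) iff the NAE-3SAT instance is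
NAE-satisfiable. -/
theorem stmt9 {m n : ℕ} (C : Fin n → Fin 3 → Fin m × Bool) :
    (∃ pol : Fin n → Fin 3 → Bool,
        ∀ x : CPPElem m n, ¬ Relation.TransGen (polPairs C pol) x x) ↔
      NAESatisfiable C := by
  constructor
  · rintro ⟨pol, hp⟩
    classical
    have key : ∀ i j, (decide (Relation.TransGen (polPairs C pol)
        (Sum.inl ((C i j).1, true)) (Sum.inl ((C i j).1, false))) = (C i j).2) ↔
        pol i j = false := by
      intro i j
      cases h : pol i j
      · obtain ⟨a, b, c⟩ := polPairs_fwd C pol i j h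
        have t := ((Relation.TransGen.single a).tail b).tail c
        rcases hC : C i j with ⟨k, b⟩
        rw [hC] at t
        cases b
        · simp only [decide_eq_false_iff_not, iff_true]
          exact fun t' => hp _ (t.trans t')
        · simpa using t
      · obtain ⟨a, b, c⟩ := polPairs_bwd C pol i j h
        have t := ((Relation.TransGen.single a).tail b).tail c
        rcases hC : C i j with ⟨k, b⟩
        rw [hC] at t
        cases b
        · simpa using t
        · simp only [decide_eq_true_eq, Bool.true_eq_false, iff_false]
          exact fun t' => hp _ (t.trans t')
    refine ⟨fun k => decide (Relation.TransGen (polPairs C pol)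
        (Sum.inl (k, true)) (Sum.inl (k, false))), fun i => ⟨?_, ?_⟩⟩
    · by_contra hcon
      have hj : ∀ j, pol i j = true := by
        intro j
        by_contra h
        exact hcon ⟨j, (key i j).2 (by simpa using h)⟩
      have q := fun j => (polPairs_bwd C pol i j (hj j)).2.1
      -- (0) = (2+1) → 2 → 1 → 0
      exact hp (Sum.inr (i, 0)) (((Relation.TransGen.single (q 2)).tail (q 1)).tail (q 0))
    · by_contra hcon
      have hj : ∀ j, pol i j = false := by
        intro j
        by_contra h
        exact hcon ⟨j, fun h' => h ((key i j).1 h')⟩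
      have q := fun j => (polPairs_fwd C pol i j (hj j)).2.1
      exact hp (Sum.inr (i, 0)) (((Relation.TransGen.single (q 0)).tail (q 1)).tail (q 2))
  · rintro ⟨σ, hσ⟩
    refine ⟨fun i j => !decide (σ (C i j).1 = (C i j).2), fun x hx => ?_⟩
    have : ∀ y, Relation.TransGen
        (polPairs C (fun i j => !decide (σ (C i j).1 = (C i j).2))) x y →
        gadgetRank σ (fun i j => decide (σ (C i j).1 = (C i j).2)) x <
        gadgetRank σ (fun i j => decide (σ (C i j).1 = (C i j).2)) y := by
      intro y hy
      induction hy with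
      | single h => exact gadgetRank_lt C σ hσ _ _ h
      | tail _ h ih => exact ih.trans (gadgetRank_lt C σ hσ _ _ h)
    exact lt_irrefl _ (this x hx)
end

section
/- Consider three lists [x_1, a, b, y_1], [x_2, b, c, y_2], [x_3, c, a, y_3] (a single clause gadget of the NAE-3SAT-to-CPP reduction), where a, b, c are pairwise distinct elements not occurring among the x_j, y_j. Any polarization of these three lists that reverses none of them implies the order pairs a ≺ b, b ≺ c, c ≺ a, and any polarization that reverses all three implies b ≺ a, c ≺ b, a ≺ c; in both cases the union of the implied order pairs contains a cycle and hence is not contained in any strict partial order. Consequently, in any polarization of a CPP instance containing such a gadget that admits a strong partial order, at least one and at most two of the three lists of the gadget are reversed. -/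
/-- A strict partial order: an irreflexive and transitive relation. -/
def IsSPO {E : Type*} (P : E → E → Prop) : Prop :=
  (∀ x : E, ¬ P x x) ∧ ∀ x y z : E, P x y → P y z → P x z

/-- A relation admits a strong partial order if it is contained in some strict
partial order. -/
def AdmitsSPO {E : Type*} (R : E → E → Prop) : Prop :=
  ∃ P : E → E → Prop, IsSPO P ∧ ∀ x y : E, R x y → P x y

/-- Consider the clause gadget `[x₁, a, b, y₁], [x₂, b, c, y₂], [x₃, c, a, y₃]`
with `a, b, c` pairwise distinct and not occurring among the `xⱼ, yⱼ`.
The polarization reversing none of the three lists implies the pairs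
`a ≺ b, b ≺ c, c ≺ a`, and the one reversing all three implies
`b ≺ a, c ≺ b, a ≺ c`; in both cases the union of the implied pairs contains a
cycle, hence is not contained in any strict partial order.  Consequently, any
polarization of a CPP instance containing this gadget that admits a strong
partial order reverses at least one and at most two of the gadget's lists. -/
theorem stmt10 {E ι : Type*} (x₁ x₂ x₃ y₁ y₂ y₃ a b c : E)
    (hab : a ≠ b) (hac : a ≠ c) (hbc : b ≠ c)
    (ha : a ∉ ([x₁, x₂, x₃, y₁, y₂, y₃] : List E))
    (hb : b ∉ ([x₁, x₂, x₃, y₁, y₂, y₃] : List E))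
    (hc : c ∉ ([x₁, x₂, x₃, y₁, y₂, y₃] : List E))
    (lists : ι → List E) (i₁ i₂ i₃ : ι)
    (hi₁₂ : i₁ ≠ i₂) (hi₁₃ : i₁ ≠ i₃) (hi₂₃ : i₂ ≠ i₃)
    (h₁ : lists i₁ = [x₁, a, b, y₁]) (h₂ : lists i₂ = [x₂, b, c, y₂])
    (h₃ : lists i₃ = [x₃, c, a, y₃]) :
    (listPairs [x₁, a, b, y₁] a b ∧ listPairs [x₂, b, c, y₂] b c ∧
      listPairs [x₃, c, a, y₃] c a) ∧
    (listPairs ([x₁, a, b, y₁] : List E).reverse b a ∧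
      listPairs ([x₂, b, c, y₂] : List E).reverse c b ∧
      listPairs ([x₃, c, a, y₃] : List E).reverse a c) ∧
    ¬ AdmitsSPO (fun u v : E => listPairs [x₁, a, b, y₁] u v ∨
        listPairs [x₂, b, c, y₂] u v ∨ listPairs [x₃, c, a, y₃] u v) ∧
    ¬ AdmitsSPO (fun u v : E => listPairs ([x₁, a, b, y₁] : List E).reverse u v ∨
        listPairs ([x₂, b, c, y₂] : List E).reverse u v ∨
        listPairs ([x₃, c, a, y₃] : List E).reverse u v) ∧
    (∀ pol : ι → Bool,
      AdmitsSPO (fun u v : E =>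
          ∃ i : ι, listPairs (if pol i then (lists i).reverse else lists i) u v) →
        (pol i₁ = true ∨ pol i₂ = true ∨ pol i₃ = true) ∧
        (pol i₁ = false ∨ pol i₂ = false ∨ pol i₃ = false)) := by
  have p : ∀ x p q y : E, listPairs [x, p, q, y] p q := fun x p q y => ⟨[x], [y], rfl⟩
  have r : ∀ x p q y : E, listPairs ([x, p, q, y] : List E).reverse q p :=
    fun x p q y => ⟨[y], [x], rfl⟩
  have key : ∀ (R : E → E → Prop) (u v w : E), R u v → R v w → R w u → ¬ AdmitsSPO R := by
    rintro R u v w h1 h2 h3 ⟨P, ⟨hirr, htr⟩, hR⟩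
    exact hirr u (htr u v u (hR _ _ h1) (htr v w u (hR _ _ h2) (hR _ _ h3)))
  refine ⟨⟨p _ _ _ _, p _ _ _ _, p _ _ _ _⟩, ⟨r _ _ _ _, r _ _ _ _, r _ _ _ _⟩, ?_, ?_, ?_⟩
  · exact key _ a b c (Or.inl (p _ _ _ _)) (Or.inr (Or.inl (p _ _ _ _)))
      (Or.inr (Or.inr (p _ _ _ _)))
  · exact key _ a c b (Or.inr (Or.inr (r _ _ _ _))) (Or.inr (Or.inl (r _ _ _ _)))
      (Or.inl (r _ _ _ _))
  · intro pol h
    constructor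
    · by_contra hn
      simp only [not_or, Bool.not_eq_true] at hn
      obtain ⟨n1, n2, n3⟩ := hn
      refine key _ a b c ⟨i₁, ?_⟩ ⟨i₂, ?_⟩ ⟨i₃, ?_⟩ h
      · rw [n1, h₁]; exact p _ _ _ _
      · rw [n2, h₂]; exact p _ _ _ _
      · rw [n3, h₃]; exact p _ _ _ _
    · by_contra hn
      simp only [not_or, Bool.not_eq_false] at hn
      obtain ⟨n1, n2, n3⟩ := hn
      refine key _ a c b ⟨i₃, ?_⟩ ⟨i₂, ?_⟩ ⟨i₁, ?_⟩ h
      · rw [n3, h₃]; exact r _ _ _ _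
      · rw [n2, h₂]; exact r _ _ _ _
      · rw [n1, h₁]; exact r _ _ _ _
end

section
/- Let r be a finite set of tuples over a schema whose attributes have linearly ordered domains, and let X and Y be lists of attributes. If the order dependency X ↦ Y holds in r, then the functional dependency set(X) → set(Y) holds in r, i.e., any two tuples of r agreeing on all attributes of X agree on all attributes of Y. -/
/-- Lexicographic comparison of two tuples with respect to a list of
attributes: `s ⪯_X t`. -/
def lexLe {A : Type*} {D : A → Type*} [∀ a, LinearOrder (D a)] :
    List A → (∀ a, D a) → (∀ a, D a) → Prop
  | [], _, _ => True
  | a :: X, s, t => s a < t a ∨ (s a = t a ∧ lexLe X s t)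

/-- The order dependency `X ↦ Y` holds in `r`: for all tuples `s, t ∈ r`,
`s ⪯_X t` implies `s ⪯_Y t`. -/
def ODholds {A : Type*} {D : A → Type*} [∀ a, LinearOrder (D a)]
    (r : Set (∀ a, D a)) (X Y : List A) : Prop :=
  ∀ s ∈ r, ∀ t ∈ r, lexLe X s t → lexLe Y s t

theorem lexLe_of_agree {A : Type*} {D : A → Type*} [∀ a, LinearOrder (D a)]
    (X : List A) (s t : ∀ a, D a) (h : ∀ a ∈ X, s a = t a) : lexLe X s t := by
  induction X with
  | nil => simp [lexLe]
  | cons b X ih =>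
    exact Or.inr ⟨h b (by simp), ih (fun a ha => h a (by simp [ha]))⟩

theorem agree_of_lexLe {A : Type*} {D : A → Type*} [∀ a, LinearOrder (D a)]
    (Y : List A) (s t : ∀ a, D a) (h : lexLe Y s t) (h2 : lexLe Y t s) :
    ∀ a ∈ Y, s a = t a := by
  induction Y with
  | nil => simp
  | cons b Y ih =>
    intro a ha
    rcases h with h | ⟨h, h3⟩
    · rcases h2 with h2 | ⟨h2, _⟩
      · exact absurd h2 (lt_asymm h)
      · exact absurd h2 (ne_of_gt h)
    · rcases h2 with h2 | ⟨_, h2⟩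
      · exact absurd h (ne_of_gt h2)
      · rcases List.mem_cons.1 ha with rfl | ha
        · exact h
        · exact ih h3 h2 a ha

/-- If the order dependency `X ↦ Y` holds in a finite set of tuples `r`, then
the functional dependency `set(X) → set(Y)` holds in `r`: any two tuples of
`r` agreeing on all attributes of `X` agree on all attributes of `Y`. -/
theorem stmt13 {A : Type*} {D : A → Type*} [∀ a, LinearOrder (D a)]
    (r : Set (∀ a, D a)) (hfin : r.Finite) (X Y : List A)
    (hOD : ODholds r X Y) :
    ∀ s ∈ r, ∀ t ∈ r, (∀ a ∈ X, s a = t a) → ∀ a ∈ Y, s a = t a := by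
  intro s hs t ht h
  exact agree_of_lexLe Y s t (hOD s hs t ht (lexLe_of_agree X s t h))
    (hOD t ht s hs (lexLe_of_agree X t s (fun a ha => (h a ha).symm)))
end

section
/- Let r be a finite set of tuples over a schema whose attributes have linearly ordered domains, and let X and Y be finite sets of attributes. The FD X → Y holds in r iff for every list X' enumerating the attributes of X and every list Y' enumerating the attributes of Y, the order dependency X' ↦ X'Y' holds in r, where X'Y' denotes list concatenation. -/
theorem lexLe_of_eq {A : Type*} {D : A → Type*} [∀ a, LinearOrder (D a)]
    (L : List A) (s t : ∀ a, D a) (h : ∀ a ∈ L, s a = t a) : lexLe L s t := by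
  induction L with
  | nil => trivial
  | cons a L ih =>
    exact Or.inr ⟨h a (by simp), ih fun b hb => h b (by simp [hb])⟩

theorem lexLe_antisymm {A : Type*} {D : A → Type*} [∀ a, LinearOrder (D a)]
    (L : List A) (s t : ∀ a, D a) (h : lexLe L s t) (h' : lexLe L t s) :
    ∀ a ∈ L, s a = t a := by
  induction L with
  | nil => simp
  | cons a L ih =>
    rcases h with h | ⟨h1, h2⟩
    · rcases h' with h' | ⟨h1', _⟩
      · exact absurd h' h.asymm
      · exact absurd h1' h.ne'
    · rcases h' with h' | ⟨_, h2'⟩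
      · exact absurd h1 h'.ne'
      · intro b hb
        rcases List.mem_cons.1 hb with rfl | hb
        · exact h1
        · exact ih h2 h2' b hb

theorem lexLe_append {A : Type*} {D : A → Type*} [∀ a, LinearOrder (D a)]
    (L M : List A) (s t : ∀ a, D a) (h : lexLe L s t)
    (h' : (∀ a ∈ L, s a = t a) → lexLe M s t) : lexLe (L ++ M) s t := by
  induction L with
  | nil => exact h' (by simp)
  | cons a L ih =>
    rcases h with h | ⟨h1, h2⟩
    · exact Or.inl h
    · refine Or.inr ⟨h1, ih h2 fun hL => h' fun b hb => ?_⟩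
      rcases List.mem_cons.1 hb with rfl | hb
      · exact h1
      · exact hL b hb

/-- For finite sets of attributes `X` and `Y`, the FD `X → Y` holds in the
finite set of tuples `r` iff for every list `X'` enumerating the attributes of
`X` (a duplicate-free list with the same members) and every list `Y'`
enumerating the attributes of `Y`, the order dependency `X' ↦ X'Y'` holds in
`r`. -/
theorem stmt14 {A : Type*} {D : A → Type*} [∀ a, LinearOrder (D a)]
    (r : Set (∀ a, D a)) (hfin : r.Finite) (X Y : Finset A) :
    (∀ s ∈ r, ∀ t ∈ r, (∀ a ∈ X, s a = t a) → ∀ a ∈ Y, s a = t a) ↔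
      (∀ X' Y' : List A, X'.Nodup → (∀ a, a ∈ X' ↔ a ∈ X) →
        Y'.Nodup → (∀ a, a ∈ Y' ↔ a ∈ Y) → ODholds r X' (X' ++ Y')) := by
  constructor
  · intro H X' Y' _ hX _ hY s hs t ht hst
    refine lexLe_append _ _ _ _ hst fun he => lexLe_of_eq _ _ _ fun a ha => ?_
    exact H s hs t ht (fun b hb => he b ((hX b).2 hb)) a ((hY a).1 ha)
  · intro H s hs t ht he a ha
    have K := H X.toList Y.toList X.nodup_toList (fun _ => Finset.mem_toList)
      Y.nodup_toList (fun _ => Finset.mem_toList)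
    have h1 := K s hs t ht
      (lexLe_of_eq _ _ _ fun b hb => he b (Finset.mem_toList.1 hb))
    have h2 := K t ht s hs
      (lexLe_of_eq _ _ _ fun b hb => (he b (Finset.mem_toList.1 hb)).symm)
    exact lexLe_antisymm _ _ _ h1 h2 a (by simp [ha])
end

section
/- Let r be a finite set of tuples over a schema whose attributes have linearly ordered domains, let X' be a list of attributes with underlying set X, and let A and B be single attributes. Then the order dependency X'A ↦ X'B holds in r iff both the canonical order compatibility [X]: A ~ B holds in r and the FD X ∪ {A} → B holds in r. -/
theorem lexLe_append_of_eq {A : Type*} {D : A → Type*} [∀ a, LinearOrder (D a)]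
    (X : List A) (c : A) (s t : ∀ a, D a) (h : ∀ x ∈ X, s x = t x) :
    lexLe (X ++ [c]) s t ↔ s c ≤ t c := by
  induction X with
  | nil => simp [lexLe, le_iff_lt_or_eq]
  | cons y X ih =>
    have h1 : s y = t y := h y (by simp)
    have h2 := ih (fun x hx => h x (by simp [hx]))
    simp [lexLe, h1, h2]

theorem lexLe_append_of_ne {A : Type*} {D : A → Type*} [∀ a, LinearOrder (D a)]
    (X : List A) (c d : A) (s t : ∀ a, D a) (h : ¬ ∀ x ∈ X, s x = t x) :
    lexLe (X ++ [c]) s t → lexLe (X ++ [d]) s t := by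
  induction X with
  | nil => simp at h
  | cons y X ih =>
    rintro (h1 | ⟨h1, h2⟩)
    · exact Or.inl h1
    · refine Or.inr ⟨h1, ih (fun h3 => h ?_) h2⟩
      intro x hx
      rcases List.mem_cons.1 hx with rfl | hx
      · exact h1
      · exact h3 x hx

/-- The order dependency `X'A ↦ X'B` holds in the finite set of tuples `r`
iff both the canonical order compatibility `[X]: A ~ B` holds in `r` (within
every partition group of `r` by the underlying set `X` of `X'` there is no
swap: no tuples `s, t` with `s.A < t.A` and `t.B < s.B`) and the FD
`X ∪ {A} → B` holds in `r`. -/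
theorem stmt16 {A : Type*} {D : A → Type*} [∀ a, LinearOrder (D a)]
    (r : Set (∀ a, D a)) (hfin : r.Finite) (X' : List A) (a b : A) :
    ODholds r (X' ++ [a]) (X' ++ [b]) ↔
      ((∀ s ∈ r, ∀ t ∈ r, (∀ x ∈ X', s x = t x) → ¬ (s a < t a ∧ t b < s b)) ∧
       (∀ s ∈ r, ∀ t ∈ r, ((∀ x ∈ X', s x = t x) ∧ s a = t a) → s b = t b)) := by
  constructor
  · intro H
    have K : ∀ s ∈ r, ∀ t ∈ r, (∀ x ∈ X', s x = t x) → s a ≤ t a → s b ≤ t b := by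
      intro s hs t ht h hab
      exact (lexLe_append_of_eq X' b s t h).1
        (H s hs t ht ((lexLe_append_of_eq X' a s t h).2 hab))
    refine ⟨fun s hs t ht h hh => ?_, fun s hs t ht h => ?_⟩
    · exact absurd (K s hs t ht h hh.1.le) (not_le.2 hh.2)
    · exact le_antisymm (K s hs t ht h.1 h.2.le)
        (K t ht s hs (fun x hx => (h.1 x hx).symm) h.2.ge)
  · rintro ⟨H1, H2⟩ s hs t ht hst
    by_cases h : ∀ x ∈ X', s x = t x
    · rw [lexLe_append_of_eq X' _ s t h] at hst ⊢
      rcases hst.lt_or_eq with hlt | heq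
      · exact not_lt.1 fun hb => H1 s hs t ht h ⟨hlt, hb⟩
      · exact (H2 s hs t ht ⟨h, heq⟩).le
    · exact lexLe_append_of_ne X' a b s t h hst
end
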